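/- arXiv:2004.00115 — 2 statements merged into one kernel-verified Lean document; each statement's English description precedes it below -/
import Mathlib

section
/- Assume α j > 0 for all j and β i j ≥ 0 for all i, j. Fix z' ∈ Fin m and let p̃' denote the unnormalized probability computed with the cause z' deleted. Assume D := ∑_{I ⊆ Fin n} (α_{z'})_{|I|} · (∏_{i∈I} β i z') · p̃'(Fin n ∖ I) > 0. Then the posterior mean of the weight of cause z' satisfies E[θ_{z'} | w] = (α_{z'} / (n + |α|)) · (∑_{I ⊆ Fin n} (α_{z'} + 1)_{|I|} · (∏_{i∈I} β i z') · p̃'(Fin n ∖ I)) / D. -/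
open MeasureTheory Real Finset

/-- The map sending `x ∈ ℝ^{m-1}` to the point `θ` of the simplex in `ℝ^m` with
`θ_j = x_j` for `j < m-1` and `θ_m = 1 - ∑ x_j`. -/
noncomputable def coordMap (m : ℕ) (x : Fin (m - 1) → ℝ) : Fin m → ℝ :=
  fun j => if hj : (j : ℕ) < m - 1 then x ⟨(j : ℕ), hj⟩ else 1 - ∑ j', x j'

/-- The domain `{x ∈ ℝ^{m-1} : x_j ≥ 0, ∑ x_j ≤ 1}` realizing the simplex. -/
def simplexDom (m : ℕ) : Set (Fin (m - 1) → ℝ) :=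
  {x | (∀ j, 0 ≤ x j) ∧ ∑ j, x j ≤ 1}

/-- The Dirichlet(α) expectation of `g`, realized as a Lebesgue integral over
`{x ∈ ℝ^{m-1} : x_j ≥ 0, ∑ x_j ≤ 1}`. -/
noncomputable def dirExp (m : ℕ) (α : Fin m → ℝ) (g : (Fin m → ℝ) → ℝ) : ℝ :=
  ∫ x in simplexDom m,
    g (coordMap m x) * (∏ j, (coordMap m x) j ^ (α j - 1)) /
      ((∏ j, Real.Gamma (α j)) / Real.Gamma (∑ j, α j))

/-- The unnormalized probability `p̃'(K)` computed with the cause `z'` deleted. -/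
noncomputable def ptildeDel (n m : ℕ) (α : Fin m → ℝ) (β : Fin n → Fin m → ℝ)
    (z' : Fin m) (K : Finset (Fin n)) : ℝ :=
  ∫ θ : {j : Fin m // j ≠ z'} → ℝ in {θ | ∀ j, 0 < θ j},
    (∏ j, θ j ^ (α j.1 - 1) * Real.exp (-θ j) / Real.Gamma (α j.1)) *
      ∏ i ∈ K, (∑ j, β i j.1 * θ j)


lemma aux_beta (a b s : ℝ) (ha : 0 < a) (hb : 0 < b) (hs : 0 < s) :
    ∫⁻ t in Set.Ioo 0 s, ENNReal.ofReal (t ^ (a-1) * (s - t) ^ (b-1)) =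
      ENNReal.ofReal (s ^ (a+b-1) * (Real.Gamma a * Real.Gamma b / Real.Gamma (a+b))) := by
  have h1 := ProbabilityTheory.lintegral_betaPDF_eq_one ha hb
  rw [ProbabilityTheory.lintegral_betaPDF] at h1
  have hB := ProbabilityTheory.beta_pos ha hb
  have him : Set.Ioo 0 s = (fun t => s * t) '' Set.Ioo 0 1 := by
    rw [Set.image_mul_left_Ioo hs]; simp
  rw [him, lintegral_image_eq_lintegral_abs_deriv_mul measurableSet_Ioo
    (f' := fun _ => s) (fun x _ => by simpa using ((hasDerivAt_id x).const_mul s).hasDerivWithinAt)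
    (fun x _ y _ h => mul_left_cancel₀ hs.ne' h)]
  have : ∀ t ∈ Set.Ioo (0:ℝ) 1, ENNReal.ofReal |s| *
      ENNReal.ofReal ((s * t) ^ (a-1) * (s - s * t) ^ (b-1)) =
      ENNReal.ofReal (s ^ (a+b-1) * ProbabilityTheory.beta a b) *
      ENNReal.ofReal (1 / ProbabilityTheory.beta a b * t ^ (a - 1) * (1 - t) ^ (b - 1)) := by
    intro t ht
    rw [← ENNReal.ofReal_mul (abs_nonneg _), ← ENNReal.ofReal_mul (by positivity)]
    congr 1
    have h0 : 0 ≤ 1 - t := by linarith [ht.2]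
    rw [abs_of_pos hs, show s - s * t = s * (1 - t) by ring, mul_rpow hs.le ht.1.le,
      mul_rpow hs.le h0, show a + b - 1 = 1 + (a - 1) + (b - 1) by ring, rpow_add hs, rpow_add hs,
      rpow_one]
    field_simp
  rw [setLIntegral_congr_fun measurableSet_Ioo this, lintegral_const_mul' _ _ ENNReal.ofReal_ne_top,
    h1, mul_one]
  rfl

lemma aux_meas (N : ℕ) (s : ℝ) :
    MeasurableSet {x : Fin N → ℝ | (∀ j, 0 ≤ x j) ∧ ∑ j, x j ≤ s} := by
  rw [show {x : Fin N → ℝ | (∀ j, 0 ≤ x j) ∧ ∑ j, x j ≤ s} =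
    (⋂ j, {x | 0 ≤ x j}) ∩ {x | ∑ j, x j ≤ s} by ext; simp]
  exact (MeasurableSet.iInter fun j => measurableSet_le measurable_const
    (measurable_pi_apply j)).inter (measurableSet_le (by fun_prop) measurable_const)

lemma aux_dir (N : ℕ) : ∀ (s : ℝ), 0 < s → ∀ (a : Fin N → ℝ) (b : ℝ), (∀ j, 0 < a j) → 0 < b →
    ∫⁻ x in {x : Fin N → ℝ | (∀ j, 0 ≤ x j) ∧ ∑ j, x j ≤ s},
      ENNReal.ofReal ((∏ j, x j ^ (a j - 1)) * (s - ∑ j, x j) ^ (b - 1)) =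
    ENNReal.ofReal (s ^ (∑ j, a j + b - 1) *
      ((∏ j, Real.Gamma (a j)) * Real.Gamma b / Real.Gamma (∑ j, a j + b))) := by
  induction N with
  | zero =>
    intro s hs a b ha hb
    have := (Real.Gamma_pos_of_pos hb).ne'
    simp [hs.le, this, Measure.volume_pi_eq_dirac (0 : Fin 0 → ℝ)]
  | succ N ih =>
    intro s hs a b ha hb
    have hA : 0 < ∑ j : Fin N, a j.succ + b :=
      add_pos_of_nonneg_of_pos (Finset.sum_nonneg fun j _ => (ha _).le) hb
    rw [← lintegral_indicator (aux_meas _ s)]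
    have hm : Measurable (Set.indicator {x : Fin (N+1) → ℝ | (∀ j, 0 ≤ x j) ∧ ∑ j, x j ≤ s}
      (fun x => ENNReal.ofReal ((∏ j, x j ^ (a j - 1)) * (s - ∑ j, x j) ^ (b - 1)))) :=
      Measurable.indicator (by fun_prop) (aux_meas _ s)
    have hm2 : Measurable (fun p : ℝ × (Fin N → ℝ) =>
      Set.indicator {x : Fin (N+1) → ℝ | (∀ j, 0 ≤ x j) ∧ ∑ j, x j ≤ s}
      (fun x => ENNReal.ofReal ((∏ j, x j ^ (a j - 1)) * (s - ∑ j, x j) ^ (b - 1)))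
      ((MeasurableEquiv.piFinSuccAbove (fun _ : Fin (N+1) => ℝ) 0).symm p)) :=
      hm.comp (MeasurableEquiv.measurable _)
    rw [← (volume_preserving_piFinSuccAbove (fun _ : Fin (N+1) => ℝ) 0).symm.lintegral_comp hm,
      Measure.volume_eq_prod, lintegral_prod _ hm2.aemeasurable]
    set C : ℝ := (∏ j : Fin N, Real.Gamma (a j.succ)) * Real.Gamma b /
      Real.Gamma (∑ j : Fin N, a j.succ + b) with hC
    have hC0 : 0 ≤ C := by
      have := Real.Gamma_pos_of_pos hA
      have := Real.Gamma_pos_of_pos hb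
      have : 0 ≤ ∏ j : Fin N, Real.Gamma (a j.succ) :=
        Finset.prod_nonneg fun j _ => (Real.Gamma_pos_of_pos (ha _)).le
      positivity
    have key : ∀ᵐ t : ℝ, (∫⁻ y : Fin N → ℝ,
        Set.indicator {x : Fin (N+1) → ℝ | (∀ j, 0 ≤ x j) ∧ ∑ j, x j ≤ s}
          (fun x => ENNReal.ofReal ((∏ j, x j ^ (a j - 1)) * (s - ∑ j, x j) ^ (b - 1)))
          ((MeasurableEquiv.piFinSuccAbove (fun _ : Fin (N+1) => ℝ) 0).symm (t, y))) =
        Set.indicator (Set.Ioo 0 s) (fun t => ENNReal.ofReal C * ENNReal.ofReal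
          (t ^ (a 0 - 1) * (s - t) ^ (∑ j : Fin N, a j.succ + b - 1))) t := by
      have h0 : ∀ᵐ t : ℝ, t ≠ 0 := by simp [ae_iff]
      have h1 : ∀ᵐ t : ℝ, t ≠ s := by simp [ae_iff]
      filter_upwards [h0, h1] with t ht0 hts
      have e1 : ∀ y : Fin N → ℝ,
        (MeasurableEquiv.piFinSuccAbove (fun _ : Fin (N+1) => ℝ) 0).symm (t, y) = Fin.cons t y := by
        intro y; simp [MeasurableEquiv.piFinSuccAbove, Fin.insertNthEquiv]
      simp only [e1]
      by_cases ht : t ∈ Set.Ioo 0 s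
      · rw [Set.indicator_of_mem ht]
        have hst : 0 < s - t := by linarith [ht.2]
        have e2 : ∀ y : Fin N → ℝ,
          Set.indicator {x : Fin (N+1) → ℝ | (∀ j, 0 ≤ x j) ∧ ∑ j, x j ≤ s}
          (fun x => ENNReal.ofReal ((∏ j, x j ^ (a j - 1)) * (s - ∑ j, x j) ^ (b - 1)))
          (Fin.cons t y : Fin (N+1) → ℝ) = ENNReal.ofReal (t ^ (a 0 - 1)) *
          Set.indicator {x : Fin N → ℝ | (∀ j, 0 ≤ x j) ∧ ∑ j, x j ≤ s - t}
          (fun x => ENNReal.ofReal ((∏ j, x j ^ (a j.succ - 1)) * (s - t - ∑ j, x j) ^ (b - 1))) y := by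
          intro y
          by_cases hy : y ∈ {x : Fin N → ℝ | (∀ j, 0 ≤ x j) ∧ ∑ j, x j ≤ s - t}
          · rw [Set.indicator_of_mem, Set.indicator_of_mem hy,
              ← ENNReal.ofReal_mul (rpow_nonneg ht.1.le _)]
            · simp only [Fin.prod_univ_succ, Fin.sum_univ_succ, Fin.cons_zero, Fin.cons_succ]
              congr 1
              rw [sub_add_eq_sub_sub]; ring
            · simp only [Set.mem_ofPred_eq, Fin.forall_fin_succ, Fin.sum_univ_succ, Fin.cons_zero,
                Fin.cons_succ]
              exact ⟨⟨ht.1.le, hy.1⟩, by linarith [hy.2]⟩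
          · rw [Set.indicator_of_notMem, Set.indicator_of_notMem hy, mul_zero]
            simp only [Set.mem_ofPred_eq, Fin.forall_fin_succ, Fin.sum_univ_succ, Fin.cons_zero,
                Fin.cons_succ]
            rintro ⟨⟨_, h⟩, h'⟩
            exact hy ⟨h, by linarith⟩
        simp only [e2]
        rw [lintegral_const_mul' _ _ ENNReal.ofReal_ne_top, lintegral_indicator (aux_meas _ _),
          ih (s - t) hst (fun j => a j.succ) b (fun j => ha _) hb,
          ← ENNReal.ofReal_mul (rpow_nonneg ht.1.le _), ← ENNReal.ofReal_mul hC0]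
        congr 1
        ring
      · rw [Set.indicator_of_notMem ht]
        rw [lintegral_eq_zero_of_ae_eq_zero]
        refine Filter.Eventually.of_forall fun y => ?_
        apply Set.indicator_of_notMem
        simp only [Set.mem_ofPred_eq, Fin.forall_fin_succ, Fin.sum_univ_succ, Fin.cons_zero,
                Fin.cons_succ]
        rintro ⟨⟨h, h2⟩, h'⟩
        have : 0 ≤ ∑ j, y j := Finset.sum_nonneg fun j _ => h2 j
        exact ht ⟨lt_of_le_of_ne h (Ne.symm ht0), lt_of_le_of_ne (by linarith) hts⟩
    rw [lintegral_congr_ae key, lintegral_indicator measurableSet_Ioo,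
      lintegral_const_mul' _ _ ENNReal.ofReal_ne_top, aux_beta _ _ _ (ha 0) hA hs,
      ← ENNReal.ofReal_mul hC0, hC]
    have := (Real.Gamma_pos_of_pos hA).ne'
    congr 1
    rw [Fin.sum_univ_succ, Fin.prod_univ_succ, ← add_assoc]
    field_simp

lemma aux_step {ι : Type*} [Fintype ι] [DecidableEq ι] (θ a : ι → ℝ) (hθ : ∀ j, 0 ≤ θ j)
    (ha : ∀ j, 0 < a j) (j₀ : ι) :
    (∏ j, θ j ^ (a j - 1)) * θ j₀ = ∏ j, θ j ^ (Function.update a j₀ (a j₀ + 1) j - 1) := by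
  rw [← Finset.mul_prod_erase _ _ (Finset.mem_univ j₀),
    ← Finset.mul_prod_erase (f := fun j => θ j ^ (Function.update a j₀ (a j₀ + 1) j - 1))
      _ (Finset.mem_univ j₀)]
  have h : ∏ x ∈ univ.erase j₀, θ x ^ (Function.update a j₀ (a j₀ + 1) x - 1) =
      ∏ x ∈ univ.erase j₀, θ x ^ (a x - 1) := by
    refine Finset.prod_congr rfl fun x hx => ?_
    rw [Function.update_of_ne (Finset.ne_of_mem_erase hx)]
  rw [h, Function.update_self]
  have : θ j₀ ^ (a j₀ + 1 - 1) = θ j₀ ^ (a j₀ - 1) * θ j₀ := by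
    rcases (hθ j₀).eq_or_lt with h0 | h0
    · rw [← h0, mul_zero, add_sub_cancel_right, zero_rpow (ha j₀).ne']
    · rw [show a j₀ + 1 - 1 = a j₀ - 1 + 1 by ring, rpow_add_one h0.ne']
  rw [this]; ring

lemma aux_upd {ι : Type*} [DecidableEq ι] (a : ι → ℝ)
    (ha : ∀ j, 0 < a j) (j₀ : ι) : ∀ j, 0 < Function.update a j₀ (a j₀ + 1) j := by
  intro j
  by_cases h : j = j₀
  · subst h; rw [Function.update_self]; linarith [ha j]
  · rw [Function.update_of_ne h]; exact ha j

lemma aux_pt {ι κ : Type*} [Fintype ι] [DecidableEq ι] [DecidableEq κ] (θ a : ι → ℝ)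
    (hθ : ∀ j, 0 ≤ θ j) (ha : ∀ j, 0 < a j) (r : ℝ) (β : κ → ι → ℝ) (K : Finset κ) (i : κ)
    (hi : i ∉ K) :
    (∏ j, θ j ^ (a j - 1)) * r * ∏ i ∈ insert i K, ∑ j, β i j * θ j =
    ∑ j₀, β i j₀ * ((∏ j, θ j ^ (Function.update a j₀ (a j₀ + 1) j - 1)) * r *
      ∏ i ∈ K, ∑ j, β i j * θ j) := by
  rw [Finset.prod_insert hi, Finset.sum_mul, Finset.mul_sum]
  refine Finset.sum_congr rfl fun j _ => ?_
  rw [← aux_step θ a hθ ha]; ring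

lemma aux_gen {X ι κ : Type*} [MeasurableSpace X] (μ : Measure X) [Fintype ι] [DecidableEq ι]
    [DecidableEq κ] (c : X → ι → ℝ) (r : X → ℝ) (hc : ∀ᵐ x ∂μ, ∀ j, 0 ≤ c x j)
    (hW : ∀ a : ι → ℝ, (∀ j, 0 < a j) → Integrable (fun x => (∏ j, c x j ^ (a j - 1)) * r x) μ)
    (β : κ → ι → ℝ) (K : Finset κ) : ∀ a : ι → ℝ, (∀ j, 0 < a j) →
    Integrable (fun x => (∏ j, c x j ^ (a j - 1)) * r x * ∏ i ∈ K, ∑ j, β i j * c x j) μ := by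
  induction K using Finset.induction_on with
  | empty => intro a ha; simpa using hW a ha
  | insert i K hi ih =>
    intro a ha
    have : Integrable (fun x => ∑ j₀, β i j₀ * ((∏ j, c x j ^
        (Function.update a j₀ (a j₀ + 1) j - 1)) * r x * ∏ i ∈ K, ∑ j, β i j * c x j)) μ :=
      integrable_finsetSum _ fun j _ => (ih _ (aux_upd a ha j)).const_mul _
    refine this.congr ?_
    filter_upwards [hc] with x hx
    exact (aux_pt _ _ hx ha _ _ _ _ hi).symm

lemma aux_rec {X ι κ : Type*} [MeasurableSpace X] (μ : Measure X) [Fintype ι] [DecidableEq ι]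
    [DecidableEq κ] (c : X → ι → ℝ) (r : X → ℝ) (hc : ∀ᵐ x ∂μ, ∀ j, 0 ≤ c x j)
    (hW : ∀ a : ι → ℝ, (∀ j, 0 < a j) → Integrable (fun x => (∏ j, c x j ^ (a j - 1)) * r x) μ)
    (β : κ → ι → ℝ) (K : Finset κ) (a : ι → ℝ) (ha : ∀ j, 0 < a j) (i : κ) (hi : i ∉ K) :
    ∫ x, (∏ j, c x j ^ (a j - 1)) * r x * ∏ i ∈ insert i K, ∑ j, β i j * c x j ∂μ =
    ∑ j₀, β i j₀ * ∫ x, (∏ j, c x j ^ (Function.update a j₀ (a j₀ + 1) j - 1)) * r x *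
      ∏ i ∈ K, ∑ j, β i j * c x j ∂μ := by
  simp_rw [← integral_const_mul]
  rw [← integral_finsetSum _ fun j _ =>
    (aux_gen μ c r hc hW β K _ (aux_upd a ha j)).const_mul _]
  refine integral_congr_ae ?_
  filter_upwards [hc] with x hx
  exact aux_pt _ _ hx ha _ _ _ _ hi

/-- gamma side -/
noncomputable def gI {ι κ : Type*} [Fintype ι] (β : κ → ι → ℝ) (K : Finset κ) (a : ι → ℝ) : ℝ :=
  ∫ θ : ι → ℝ in {θ | ∀ j, 0 < θ j},
    (∏ j, θ j ^ (a j - 1)) * (∏ j, Real.exp (-θ j)) * ∏ i ∈ K, ∑ j, β i j * θ j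

lemma aux_res {ι : Type*} [Fintype ι] :
    (volume : Measure (ι → ℝ)).restrict {θ | ∀ j, 0 < θ j} =
      Measure.pi fun _ : ι => (volume : Measure ℝ).restrict (Set.Ioi 0) := by
  rw [← Measure.restrict_pi_pi, ← volume_pi]
  congr 1
  ext; simp

lemma gI_hc {ι : Type*} [Fintype ι] :
    ∀ᵐ θ : ι → ℝ ∂(volume : Measure (ι → ℝ)).restrict {θ | ∀ j, 0 < θ j}, ∀ j, 0 ≤ θ j := by
  have hm : MeasurableSet {θ : ι → ℝ | ∀ j, 0 < θ j} := by
    rw [show {θ : ι → ℝ | ∀ j, 0 < θ j} = ⋂ j, {x | 0 < x j} by ext; simp]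
    exact MeasurableSet.iInter fun j => measurableSet_lt measurable_const (measurable_pi_apply j)
  filter_upwards [ae_restrict_mem hm] with θ hθ j
  exact (hθ j).le

lemma gI_hW {ι : Type*} [Fintype ι] (a : ι → ℝ) (ha : ∀ j, 0 < a j) :
    Integrable (fun θ : ι → ℝ => (∏ j, θ j ^ (a j - 1)) * (∏ j, Real.exp (-θ j)))
      ((volume : Measure (ι → ℝ)).restrict {θ | ∀ j, 0 < θ j}) := by
  rw [aux_res]
  simp_rw [← Finset.prod_mul_distrib]
  refine Integrable.fintype_prod (f := fun j x => x ^ (a j - 1) * Real.exp (-x)) fun j => ?_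
  simpa [mul_comm] using! Real.GammaIntegral_convergent (ha j)

lemma gI_empty {ι κ : Type*} [Fintype ι] (β : κ → ι → ℝ) (a : ι → ℝ) (ha : ∀ j, 0 < a j) :
    gI β ∅ a = ∏ j, Real.Gamma (a j) := by
  unfold gI
  rw [aux_res]
  simp_rw [Finset.prod_empty, mul_one, ← Finset.prod_mul_distrib]
  rw [integral_fintype_prod_eq_prod (f := fun j x => x ^ (a j - 1) * Real.exp (-x))]
  refine Finset.prod_congr rfl fun j _ => ?_
  rw [Real.Gamma_eq_integral (ha j)]
  simp_rw [mul_comm]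

lemma gI_rec {ι κ : Type*} [Fintype ι] [DecidableEq ι] [DecidableEq κ] (β : κ → ι → ℝ)
    (K : Finset κ) (a : ι → ℝ) (ha : ∀ j, 0 < a j) (i : κ) (hi : i ∉ K) :
    gI β (insert i K) a = ∑ j₀, β i j₀ * gI β K (Function.update a j₀ (a j₀ + 1)) :=
  aux_rec _ (fun θ => θ) (fun θ => ∏ j, Real.exp (-θ j)) gI_hc gI_hW β K a ha i hi

noncomputable def gS {ι κ : Type*} [Fintype ι] [DecidableEq ι] [DecidableEq κ] (β : κ → ι → ℝ)
    (z : ι) (K : Finset κ) (a : ι → ℝ) : ℝ :=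
  ∑ I ∈ K.powerset, Real.Gamma (a z + I.card) * (∏ i ∈ I, β i z) *
    gI (fun i (j : {j // j ≠ z}) => β i j.1) (K \ I) (fun j => a j.1)

lemma gS_empty {ι κ : Type*} [Fintype ι] [DecidableEq ι] [DecidableEq κ] (β : κ → ι → ℝ)
    (z : ι) (a : ι → ℝ) (ha : ∀ j, 0 < a j) : gS β z ∅ a = ∏ j, Real.Gamma (a j) := by
  simp [gS, gI_empty _ _ fun j : {j // j ≠ z} => ha j.1]
  rw [Fintype.prod_eq_mul_prod_subtype_ne _ z]

lemma gS_rec {ι κ : Type*} [Fintype ι] [DecidableEq ι] [DecidableEq κ] (β : κ → ι → ℝ)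
    (z : ι) (K : Finset κ) (a : ι → ℝ) (ha : ∀ j, 0 < a j) (i : κ) (hi : i ∉ K) :
    gS β z (insert i K) a = ∑ j₀, β i j₀ * gS β z K (Function.update a j₀ (a j₀ + 1)) := by
  rw [Fintype.sum_eq_add_sum_subtype_ne _ z]
  unfold gS
  rw [Finset.sum_powerset_insert hi, add_comm]
  congr 1
  · rw [Finset.mul_sum]
    refine Finset.sum_congr rfl fun I hI => ?_
    have hI' := Finset.mem_powerset.1 hI
    have hiI : i ∉ I := fun h => hi (hI' h)
    rw [Finset.card_insert_of_notMem hiI, Finset.prod_insert hiI, Function.update_self]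
    have e1 : insert i K \ insert i I = K \ I := by
      ext x; simp only [mem_sdiff, mem_insert]; grind
    have e2 : (fun j : {j // j ≠ z} => Function.update a z (a z + 1) j.1) = fun j => a j.1 := by
      ext j; rw [Function.update_of_ne j.2]
    rw [e1, e2]
    push_cast
    rw [add_assoc, add_comm (1:ℝ)]; ring
  · simp_rw [Finset.mul_sum]
    rw [Finset.sum_comm]
    refine Finset.sum_congr rfl fun I hI => ?_
    have hI' := Finset.mem_powerset.1 hI
    have hiI : i ∉ I := fun h => hi (hI' h)
    rw [Finset.insert_sdiff_of_notMem _ hiI, gI_rec _ (K \ I) (fun j : {j // j ≠ z} => a j.1) (fun j : {j // j ≠ z} => ha j.1) i (by simp [hi]),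
      Finset.mul_sum]
    refine Finset.sum_congr rfl fun j _ => ?_
    have e2 : (fun k : {j // j ≠ z} => Function.update a j.1 (a j.1 + 1) k.1) =
        Function.update (fun k : {j // j ≠ z} => a k.1) j (a j.1 + 1) := by
      ext k
      by_cases h : k = j
      · subst h; simp
      · rw [Function.update_of_ne h, Function.update_of_ne (fun h' => h (Subtype.ext h'))]
    rw [e2, Function.update_of_ne (Ne.symm j.2)]
    ring

lemma dI_mem (m : ℕ) (x : Fin (m - 1) → ℝ) (hx : x ∈ simplexDom m) (j : Fin m) :
    0 ≤ coordMap m x j := by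
  unfold coordMap
  split_ifs with h
  · exact hx.1 _
  · have := hx.2
    linarith

lemma dI_hc (m : ℕ) :
    ∀ᵐ x ∂(volume : Measure (Fin (m - 1) → ℝ)).restrict (simplexDom m),
      ∀ j, 0 ≤ coordMap m x j := by
  filter_upwards [ae_restrict_mem (aux_meas (m - 1) 1)] with x hx
  exact dI_mem m x hx

lemma dI_meas (m : ℕ) (j : Fin m) : Measurable fun x => coordMap m x j := by
  unfold coordMap
  split_ifs <;> fun_prop

lemma dI_lint (m : ℕ) (hm : 2 ≤ m) (a : Fin m → ℝ) (ha : ∀ j, 0 < a j) :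
    ∫⁻ x in simplexDom m, ENNReal.ofReal (∏ j, coordMap m x j ^ (a j - 1)) =
      ENNReal.ofReal ((∏ j, Real.Gamma (a j)) / Real.Gamma (∑ j, a j)) := by
  obtain ⟨N, rfl⟩ : ∃ N, m = N + 1 := ⟨m - 1, by omega⟩
  have h := aux_dir N 1 one_pos (fun j => a j.castSucc) (a (Fin.last N)) (fun j => ha _) (ha _)
  rw [one_rpow, one_mul, ← Fin.sum_univ_castSucc, ← Fin.prod_univ_castSucc
    (f := fun j => Real.Gamma (a j))] at h
  rw [← h]
  refine lintegral_congr fun x => ?_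
  rw [Fin.prod_univ_castSucc]
  simp [coordMap]

lemma dI_hW (m : ℕ) (hm : 2 ≤ m) (a : Fin m → ℝ) (ha : ∀ j, 0 < a j) :
    Integrable (fun x => (∏ j, coordMap m x j ^ (a j - 1)) * (1 : ℝ))
      ((volume : Measure (Fin (m - 1) → ℝ)).restrict (simplexDom m)) := by
  have hme := dI_meas m
  simp_rw [mul_one]
  refine ⟨Measurable.aestronglyMeasurable (by fun_prop), ?_⟩
  rw [hasFiniteIntegral_iff_ofReal, dI_lint m hm a ha]
  · exact ENNReal.ofReal_lt_top
  · filter_upwards [dI_hc m] with x hx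
    exact Finset.prod_nonneg fun j _ => rpow_nonneg (hx j) _

noncomputable def dI {κ : Type*} (m : ℕ) (β : κ → Fin m → ℝ) (K : Finset κ) (a : Fin m → ℝ) : ℝ :=
  ∫ x in simplexDom m, (∏ j, coordMap m x j ^ (a j - 1)) * (1 : ℝ) *
    ∏ i ∈ K, ∑ j, β i j * coordMap m x j

lemma dI_empty {κ : Type*} (m : ℕ) (hm : 2 ≤ m) (β : κ → Fin m → ℝ) (a : Fin m → ℝ)
    (ha : ∀ j, 0 < a j) :
    dI m β ∅ a = (∏ j, Real.Gamma (a j)) / Real.Gamma (∑ j, a j) := by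
  have hme := dI_meas m
  unfold dI
  simp_rw [Finset.prod_empty, mul_one]
  rw [integral_eq_lintegral_of_nonneg_ae, dI_lint m hm a ha, ENNReal.toReal_ofReal]
  · exact div_nonneg (Finset.prod_nonneg fun j _ => (Real.Gamma_pos_of_pos (ha j)).le)
      (Real.Gamma_nonneg_of_nonneg (Finset.sum_nonneg fun j _ => (ha j).le))
  · filter_upwards [dI_hc m] with x hx
    exact Finset.prod_nonneg fun j _ => rpow_nonneg (hx j) _
  · exact Measurable.aestronglyMeasurable (by fun_prop)

lemma sum_upd {m : ℕ} (a : Fin m → ℝ) (j : Fin m) :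
    ∑ k, Function.update a j (a j + 1) k = ∑ k, a k + 1 := by
  rw [Finset.sum_update_of_mem (Finset.mem_univ j), Finset.sum_eq_add_sum_sdiff_singleton_of_mem
    (Finset.mem_univ j) a]
  ring

lemma sum_pos' {m : ℕ} (hm : 2 ≤ m) (a : Fin m → ℝ) (ha : ∀ j, 0 < a j) : 0 < ∑ j, a j :=
  Finset.sum_pos (fun j _ => ha j) ⟨⟨0, by omega⟩, Finset.mem_univ _⟩

lemma dI_main {κ : Type*} [DecidableEq κ] (m : ℕ) (hm : 2 ≤ m) (β : κ → Fin m → ℝ) (z : Fin m)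
    (K : Finset κ) : ∀ a : Fin m → ℝ, (∀ j, 0 < a j) →
    dI m β K a * Real.Gamma (∑ j, a j + K.card) = gS β z K a := by
  induction K using Finset.induction_on with
  | empty =>
    intro a ha
    have := (Real.Gamma_pos_of_pos (sum_pos' hm a ha)).ne'
    rw [dI_empty m hm β a ha, gS_empty β z a ha]
    simp only [Finset.card_empty, Nat.cast_zero, add_zero]
    field_simp
  | insert i K hi ih =>
    intro a ha
    have h := aux_rec _ (coordMap m) (fun _ => 1) (dI_hc m) (dI_hW m hm) β K a ha i hi
    change dI m β (insert i K) a = ∑ j₀, β i j₀ * dI m β K (Function.update a j₀ (a j₀ + 1)) at h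
    rw [h, gS_rec β z K a ha i hi, Finset.sum_mul]
    refine Finset.sum_congr rfl fun j _ => ?_
    rw [← ih _ (aux_upd a ha j), sum_upd, Finset.card_insert_of_notMem hi]
    push_cast
    rw [add_assoc, add_comm (1 : ℝ)]; ring

lemma ptilde_eq (n m : ℕ) (α : Fin m → ℝ) (β : Fin n → Fin m → ℝ)
    (z' : Fin m) (K : Finset (Fin n)) :
    ptildeDel n m α β z' K = (∏ j : {j // j ≠ z'}, Real.Gamma (α j.1))⁻¹ *
      gI (fun i (j : {j // j ≠ z'}) => β i j.1) K (fun j => α j.1) := by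
  unfold ptildeDel gI
  rw [← integral_const_mul]
  congr 1
  ext θ
  rw [Finset.prod_div_distrib, Finset.prod_mul_distrib]
  ring

lemma gamma_poch (a : ℝ) (ha : 0 < a) (k : ℕ) :
    Real.Gamma (a + k) = Real.Gamma a * (ascPochhammer ℝ k).eval a := by
  induction k with
  | zero => simp
  | succ k ih =>
    rw [ascPochhammer_succ_eval, ← mul_assoc, ← ih]
    push_cast
    rw [← add_assoc, Real.Gamma_add_one (by positivity)]; ring

lemma gS_eq (n m : ℕ) (α : Fin m → ℝ) (hα : ∀ j, 0 < α j) (β : Fin n → Fin m → ℝ) (z' : Fin m)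
    (a : Fin m → ℝ) (ha : 0 < a z') (hh : ∀ j, j ≠ z' → a j = α j) :
    gS β z' univ a = Real.Gamma (a z') * (∏ j : {j // j ≠ z'}, Real.Gamma (α j.1)) *
      ∑ I : Finset (Fin n), (ascPochhammer ℝ I.card).eval (a z') * (∏ i ∈ I, β i z') *
          ptildeDel n m α β z' (Finset.univ \ I) := by
  unfold gS
  rw [Finset.powerset_univ, Finset.mul_sum]
  refine Finset.sum_congr rfl fun I _ => ?_
  have hP : (∏ j : {j // j ≠ z'}, Real.Gamma (α j.1)) ≠ 0 :=
    Finset.prod_ne_zero_iff.2 fun j _ => (Real.Gamma_pos_of_pos (hα _)).ne'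
  have e : (fun j : {j // j ≠ z'} => a j.1) = fun j => α j.1 := by
    ext j; exact hh _ j.2
  rw [ptilde_eq, gamma_poch _ ha, e]
  field_simp

theorem posterior_mean_last_cause (n m : ℕ) (hn : 1 ≤ n) (hm : 2 ≤ m)
    (α : Fin m → ℝ) (hα : ∀ j, 0 < α j)
    (β : Fin n → Fin m → ℝ) (hβ : ∀ i j, 0 ≤ β i j) (z' : Fin m)
    (hD : 0 < ∑ I : Finset (Fin n),
        (ascPochhammer ℝ I.card).eval (α z') * (∏ i ∈ I, β i z') *
          ptildeDel n m α β z' (Finset.univ \ I)) :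
    dirExp m α (fun θ => θ z' * ∏ i : Fin n, ∑ j, β i j * θ j) /
        dirExp m α (fun θ => ∏ i : Fin n, ∑ j, β i j * θ j)
      = α z' / (n + ∑ j, α j) *
          ((∑ I : Finset (Fin n),
              (ascPochhammer ℝ I.card).eval (α z' + 1) * (∏ i ∈ I, β i z') *
                ptildeDel n m α β z' (Finset.univ \ I)) /
            (∑ I : Finset (Fin n),
              (ascPochhammer ℝ I.card).eval (α z') * (∏ i ∈ I, β i z') *
                ptildeDel n m α β z' (Finset.univ \ I))) := by
  have hS := sum_pos' hm α hα
  set B : ℝ := (∏ j, Real.Gamma (α j)) / Real.Gamma (∑ j, α j) with hB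
  have hB0 : B ≠ 0 := div_ne_zero
    (Finset.prod_ne_zero_iff.2 fun j _ => (Real.Gamma_pos_of_pos (hα _)).ne')
    (Real.Gamma_pos_of_pos hS).ne'
  have h1 : dirExp m α (fun θ => ∏ i : Fin n, ∑ j, β i j * θ j) = dI m β univ α / B := by
    unfold dirExp dI
    rw [← integral_div]
    congr 1
    ext x
    rw [mul_one, mul_comm (∏ j, coordMap m x j ^ (α j - 1))]
  have h2 : dirExp m α (fun θ => θ z' * ∏ i : Fin n, ∑ j, β i j * θ j) =
      dI m β univ (Function.update α z' (α z' + 1)) / B := by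
    unfold dirExp dI
    rw [← integral_div]
    refine integral_congr_ae ?_
    filter_upwards [dI_hc m] with x hx
    rw [← aux_step _ _ hx hα, ← hB]
    ring
  have m1 := dI_main m hm β z' univ α hα
  have m2 := dI_main m hm β z' univ _ (aux_upd α hα z')
  rw [gS_eq n m α hα β z' α (hα z') (fun _ _ => rfl)] at m1
  rw [gS_eq n m α hα β z' _ (aux_upd α hα z' z') (fun j hj => Function.update_of_ne hj _ _),
    sum_upd, Function.update_self, Real.Gamma_add_one (hα z').ne', Finset.card_univ,
    Fintype.card_fin, show ∑ j, α j + 1 + (n : ℝ) = ∑ j, α j + n + 1 by ring,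
    Real.Gamma_add_one (by positivity)] at m2
  rw [Finset.card_univ, Fintype.card_fin] at m1
  have hP : (∏ j : {j // j ≠ z'}, Real.Gamma (α j.1)) ≠ 0 :=
    Finset.prod_ne_zero_iff.2 fun j _ => (Real.Gamma_pos_of_pos (hα _)).ne'
  have hG := (Real.Gamma_pos_of_pos (hα z')).ne'
  have hT : 0 < ∑ j, α j + (n : ℝ) := by positivity
  have hGT := (Real.Gamma_pos_of_pos hT).ne'
  rw [h1, h2, div_div_div_cancel_right₀ hB0, eq_div_of_mul_eq hGT m1,
    eq_div_of_mul_eq (mul_ne_zero hT.ne' hGT) m2, add_comm (n : ℝ)]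
  have hD' := hD.ne'
  set D := ∑ I : Finset (Fin n), (ascPochhammer ℝ I.card).eval (α z') * (∏ i ∈ I, β i z') *
          ptildeDel n m α β z' (Finset.univ \ I)
  field_simp
end

section
/- Assume α j > 0 for all j, fix z' ∈ Fin m with α_{z'} = 1, and assume β i z' = ε for all i, where ε > 0, while β i j ≥ 0 for all i and all j ≠ z'. Let p̃' denote the unnormalized probability computed with the cause z' deleted, and set e_k := ∑_{I ⊆ Fin n, |I| = k} p̃'(Fin n ∖ I) for k = 0, 1, …, n. Then (n + |α|) · E[θ_{z'} | w] = (∑_{k=0}^n (k+1)! · e_k · ε^k) / (∑_{k=0}^n k! · e_k · ε^k), and the denominator is strictly positive. -/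
open MeasureTheory Real Finset

lemma vc_shear (k : ℕ) (f : (Fin (k+1) → ℝ) → ENNReal) (hf : Measurable f) :
    ∫⁻ θ, f θ = ∫⁻ s : ℝ, ∫⁻ x : Fin k → ℝ, f (Fin.snoc (α := fun _ => ℝ) x (s - ∑ j, x j)) := by
  have h1 := (volume_preserving_piFinSuccAbove (fun _ : Fin (k+1) => ℝ) (Fin.last k)).symm
  have hins : ∀ p : ℝ × (Fin k → ℝ), (MeasurableEquiv.piFinSuccAbove (fun _ : Fin (k+1) => ℝ) (Fin.last k)).symm p = Fin.snoc (α := fun _ => ℝ) p.2 p.1 := by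
    intro p
    simp [MeasurableEquiv.piFinSuccAbove, Fin.insertNthEquiv, Fin.insertNth_last']
  have hm : Measurable fun p : ℝ × (Fin k → ℝ) => f (Fin.snoc (α := fun _ => ℝ) p.2 p.1) := by
    simp_rw [← hins]
    exact hf.comp (MeasurableEquiv.measurable _)
  rw [← h1.lintegral_comp hf]
  simp_rw [hins]
  rw [Measure.volume_eq_prod, lintegral_prod_symm _ hm.aemeasurable]
  rw [lintegral_lintegral_swap (f := fun (s : ℝ) (x : Fin k → ℝ) => f (Fin.snoc (α := fun _ => ℝ) x (s - ∑ j, x j)))]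
  · refine lintegral_congr fun x => ?_
    exact (lintegral_sub_right_eq_self (fun t => f (Fin.snoc (α := fun _ => ℝ) x t)) (∑ j, x j)).symm
  · have : Measurable fun p : ℝ × (Fin k → ℝ) => (p.1 - ∑ j, p.2 j, p.2) := by fun_prop
    exact (hm.comp this).aemeasurable

lemma vc_scale (k : ℕ) (h : (Fin k → ℝ) → ENNReal) (hh : Measurable h) (s : ℝ) (hs : 0 < s) :
    ∫⁻ x, h x = ENNReal.ofReal (s ^ k) * ∫⁻ x, h (s • x) := by
  have := Measure.map_addHaar_smul (volume : Measure (Fin k → ℝ)) hs.ne'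
  rw [← lintegral_map (μ := volume) hh (measurable_const_smul s), this, lintegral_smul_measure, smul_eq_mul, ← mul_assoc,
    ← ENNReal.ofReal_mul (by positivity), abs_of_pos (by simp; positivity)]
  simp [mul_inv_cancel₀ (pow_pos hs k).ne']

lemma vc_coord (k : ℕ) (x : Fin k → ℝ) :
    coordMap (k+1) x = Fin.snoc (α := fun _ => ℝ) x (1 - ∑ j, x j) := by
  funext j
  refine Fin.lastCases ?_ (fun i => ?_) j
  · simp [coordMap]
  · simp [coordMap]

lemma vc_polar (k : ℕ) (f : (Fin (k+1) → ℝ) → ENNReal) (hf : Measurable f)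
    (hf0 : ∀ θ, (∃ j, θ j < 0) → f θ = 0) :
    ∫⁻ θ, f θ = ∫⁻ s in Set.Ioi (0:ℝ), ENNReal.ofReal (s ^ k) *
      ∫⁻ x : Fin k → ℝ, f (s • coordMap (k+1) x) := by
  rw [vc_shear k f hf, ← lintegral_indicator measurableSet_Ioi]
  refine lintegral_congr_ae ?_
  filter_upwards [Measure.ae_ne volume (0:ℝ)] with s hs0
  rcases lt_or_gt_of_ne hs0 with hs | hs
  · rw [Set.indicator_of_notMem (by simp [hs.le])]
    refine (lintegral_congr fun x => hf0 _ ?_).trans lintegral_zero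
    by_contra! hc
    have h1 := hc (Fin.last k)
    have h2 : 0 ≤ ∑ j, x j := Finset.sum_nonneg fun j _ => by simpa using hc (Fin.castSucc j)
    simp at h1
    linarith
  · rw [Set.indicator_of_mem (by simpa using hs), vc_scale k _ ?_ s hs]
    · congr 1
      refine lintegral_congr fun x => ?_
      rw [vc_coord]
      congr 1
      funext j
      refine Fin.lastCases ?_ (fun i => ?_) j
      · simp [mul_sub, Finset.mul_sum]
      · simp
    · refine hf.comp ?_
      refine measurable_pi_lambda _ fun j => ?_
      refine Fin.lastCases ?_ (fun i => ?_) j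
      · simp; fun_prop
      · simp; fun_prop

lemma vc_gamma_int (a : ℝ) (ha : 0 < a) :
    Integrable (fun x : ℝ => x ^ (a - 1) * Real.exp (-x)) (volume.restrict (Set.Ioi 0)) := by
  have := Real.GammaIntegral_convergent ha
  simpa [IntegrableOn, mul_comm] using this

lemma vc_gamma_eq (a : ℝ) (ha : 0 < a) :
    ∫ x in Set.Ioi (0:ℝ), x ^ (a - 1) * Real.exp (-x) = Real.Gamma a := by
  rw [Real.Gamma_eq_integral ha]; simp [mul_comm]

lemma vc_integrable {ι κ : Type*} [Fintype ι] [DecidableEq ι] (b : κ → ι → ℝ) (K : Finset κ) :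
    ∀ a : ι → ℝ, (∀ j, 0 < a j) →
    Integrable (fun θ : ι → ℝ => (∏ j, (θ j ^ (a j - 1) * Real.exp (-θ j))) * ∏ i ∈ K, ∑ j, b i j * θ j)
      (Measure.pi fun _ => volume.restrict (Set.Ioi (0:ℝ))) := by
  classical
  induction K using Finset.induction_on with
  | empty =>
    intro a ha
    simp only [Finset.prod_empty, mul_one]
    exact Integrable.fintype_prod (f := fun j x => x ^ (a j - 1) * Real.exp (-x)) fun j => vc_gamma_int _ (ha j)
  | insert i K hi ih =>
    intro a ha
    have h1 : ∀ l : ι, Integrable (fun θ : ι → ℝ => b i l * ((∏ j, (θ j ^ ((a j + if j = l then 1 else 0) - 1) * Real.exp (-θ j))) * ∏ i ∈ K, ∑ j, b i j * θ j))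
      (Measure.pi fun _ => volume.restrict (Set.Ioi (0:ℝ))) := fun l =>
        (ih (fun j => a j + if j = l then 1 else 0) (fun j => by have := ha j; positivity)).const_mul _
    refine (integrable_finsetSum Finset.univ fun l _ => h1 l).congr ?_
    have hpos : ∀ᵐ θ : ι → ℝ ∂(Measure.pi fun _ => volume.restrict (Set.Ioi (0:ℝ))), ∀ j, 0 < θ j := by
      rw [← Measure.restrict_pi_pi]
      filter_upwards [ae_restrict_mem (MeasurableSet.univ_pi fun _ => measurableSet_Ioi)] with θ hθ
      simpa using hθ
    filter_upwards [hpos] with θ hθ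
    rw [Finset.prod_insert hi, mul_left_comm, Finset.sum_mul]
    refine Finset.sum_congr rfl fun l _ => ?_
    have : ∏ j, (θ j ^ ((a j + if j = l then 1 else 0) - 1) * Real.exp (-θ j)) = θ l * ∏ j, (θ j ^ (a j - 1) * Real.exp (-θ j)) := by
      have h2 : ∀ j, θ j ^ ((a j + if j = l then 1 else 0) - 1) * Real.exp (-θ j) = (if j = l then θ j else 1) * (θ j ^ (a j - 1) * Real.exp (-θ j)) := by
        intro j
        split_ifs with h
        · rw [show a j + 1 - 1 = (a j - 1) + 1 by ring, Real.rpow_add_one (hθ j).ne']; ring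
        · simp
      simp_rw [h2]
      rw [Finset.prod_mul_distrib]
      simp
    rw [this]; ring

lemma vc_ptilde (n k : ℕ) (α : Fin (k+1) → ℝ) (β : Fin n → Fin (k+1) → ℝ)
    (z : Fin (k+1)) (K : Finset (Fin n)) :
    ptildeDel n (k+1) α β z K = (∫ θ : Fin k → ℝ,
      (∏ j, (θ j ^ (α (z.succAbove j) - 1) * Real.exp (-θ j))) * ∏ i ∈ K, ∑ j, β i (z.succAbove j) * θ j
      ∂(Measure.pi fun _ => volume.restrict (Set.Ioi (0:ℝ)))) / ∏ j, Real.Gamma (α (z.succAbove j)) := by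
  unfold ptildeDel
  have hs : {θ : {j : Fin (k+1) // j ≠ z} → ℝ | ∀ j, 0 < θ j} = Set.pi Set.univ fun _ => Set.Ioi 0 := by
    ext θ; simp
  rw [hs, volume_pi, Measure.restrict_pi_pi]
  have hmp := measurePreserving_piCongrLeft (fun _ : {j : Fin (k+1) // j ≠ z} => volume.restrict (Set.Ioi (0:ℝ))) (finSuccAboveEquiv z)
  rw [← hmp.integral_comp', ← integral_div]
  congr 1
  funext θ
  simp only [← (finSuccAboveEquiv z).prod_comp, ← (finSuccAboveEquiv z).sum_comp,
    MeasurableEquiv.coe_piCongrLeft, Finset.prod_div_distrib, finSuccAboveEquiv_apply]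
  have hev : ∀ j, (Equiv.piCongrLeft (fun _ => ℝ) (finSuccAboveEquiv z)) θ ⟨z.succAbove j, z.succAbove_ne j⟩ = θ j :=
    fun j => Equiv.piCongrLeft_apply_apply (fun _ => ℝ) (finSuccAboveEquiv z) θ j
  simp only [hev]
  ring

lemma vc_split (n k c : ℕ) (α : Fin (k+1) → ℝ) (hα : ∀ j, 0 < α j) (β : Fin n → Fin (k+1) → ℝ)
    (z : Fin (k+1)) (hz : α z = 1) (ε : ℝ) (hβz : ∀ i, β i z = ε) :
    ∫ θ : Fin (k+1) → ℝ, (θ z ^ c * ∏ i, ∑ j, β i j * θ j) * ∏ j, (θ j ^ (α j - 1) * Real.exp (-θ j))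
      ∂(Measure.pi fun _ => volume.restrict (Set.Ioi (0:ℝ)))
    = (∏ j, Real.Gamma (α j)) * ∑ l ∈ Finset.range (n+1), ((l + c).factorial : ℝ) *
      (∑ I ∈ Finset.powersetCard l (Finset.univ : Finset (Fin n)),
        ptildeDel n (k+1) α β z (Finset.univ \ I)) * ε ^ l := by
  have hmp := (measurePreserving_piFinSuccAbove (fun _ : Fin (k+1) => volume.restrict (Set.Ioi (0:ℝ))) z).symm
  rw [← hmp.integral_comp']
  set ν := (Measure.pi fun _ : Fin k => volume.restrict (Set.Ioi (0:ℝ))) with hν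
  let F : Finset (Fin n) → (Fin k → ℝ) → ℝ := fun K θ =>
    (∏ j, (θ j ^ (α (z.succAbove j) - 1) * Real.exp (-θ j))) * ∏ i ∈ K, ∑ j, β i (z.succAbove j) * θ j
  have hF : ∀ K, Integrable (F K) ν := fun K => vc_integrable _ K _ fun j => hα _
  let G : ℕ → ℝ → ℝ := fun l t => t ^ (((l + c : ℕ) : ℝ) + 1 - 1) * Real.exp (-t)
  have hG : ∀ l, Integrable (G l) (volume.restrict (Set.Ioi 0)) := fun l => vc_gamma_int _ (by positivity)
  have hGi : ∀ l, ∫ t in Set.Ioi (0:ℝ), G l t = ((l + c).factorial : ℝ) := fun l => by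
    rw [← Real.Gamma_nat_eq_factorial]; exact vc_gamma_eq _ (by positivity)
  have key : ∀ p : ℝ × (Fin k → ℝ),
     ((MeasurableEquiv.piFinSuccAbove (fun _ => ℝ) z).symm p z ^ c * ∏ i, ∑ j, β i j * (MeasurableEquiv.piFinSuccAbove (fun _ => ℝ) z).symm p j) * ∏ j, ((MeasurableEquiv.piFinSuccAbove (fun _ => ℝ) z).symm p j ^ (α j - 1) * Real.exp (-(MeasurableEquiv.piFinSuccAbove (fun _ => ℝ) z).symm p j))
      = ∑ I ∈ (Finset.univ : Finset (Fin n)).powerset, ε ^ I.card * (G I.card p.1 * F (Finset.univ \ I) p.2) := by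
    intro p
    simp only [MeasurableEquiv.piFinSuccAbove, Fin.sum_univ_succAbove _ z, Fin.prod_univ_succAbove _ z,
      MeasurableEquiv.coe_mk, MeasurableEquiv.symm_mk, Fin.insertNthEquiv, Equiv.symm_symm, Equiv.coe_fn_mk,
      Fin.insertNth_apply_same, Fin.insertNth_apply_succAbove, hz, hβz, Finset.prod_add, Finset.prod_const, F, G]
    rw [Finset.mul_sum, Finset.sum_mul]
    refine Finset.sum_congr rfl fun I _ => ?_
    rw [add_sub_cancel_right, Real.rpow_natCast]
    simp only [sub_self, Real.rpow_zero, mul_pow, pow_add]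
    ring
  refine (integral_congr_ae (Filter.Eventually.of_forall key)).trans ?_
  rw [integral_finsetSum _ fun I _ => ((hG _).mul_prod (hF _)).const_mul _]
  have hΓ : ∏ j, Real.Gamma (α j) = ∏ j, Real.Gamma (α (z.succAbove j)) := by
    rw [Fin.prod_univ_succAbove _ z, hz, Real.Gamma_one, one_mul]
  have hΓp : ∏ j, Real.Gamma (α (z.succAbove j)) ≠ 0 :=
    (Finset.prod_pos fun j _ => Real.Gamma_pos_of_pos (hα _)).ne'
  rw [hΓ, Finset.sum_powerset, Finset.mul_sum, Finset.card_univ, Fintype.card_fin]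
  refine Finset.sum_congr rfl fun l _ => ?_
  rw [Finset.mul_sum, Finset.sum_mul, Finset.mul_sum]
  refine Finset.sum_congr rfl fun I hI => ?_
  rw [(Finset.mem_powersetCard.1 hI).2, integral_const_mul, integral_prod_mul, hGi, vc_ptilde]
  field_simp
  rfl


lemma vc_dir (k : ℕ) (α : Fin (k+1) → ℝ) (hα : ∀ j, 0 < α j) (d : ℕ) (h : (Fin (k+1) → ℝ) → ℝ)
    (hm : Measurable h) (h0 : ∀ θ, (∀ j, 0 ≤ θ j) → 0 ≤ h θ)
    (hs : ∀ (s : ℝ) θ, h (s • θ) = s ^ d * h θ) :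
    ∫ θ : Fin (k+1) → ℝ, h θ * ∏ j, (θ j ^ (α j - 1) * Real.exp (-θ j))
      ∂(Measure.pi fun _ => volume.restrict (Set.Ioi (0:ℝ)))
    = Real.Gamma (d + ∑ j, α j) * ∫ x in simplexDom (k+1),
      h (coordMap (k+1) x) * ∏ j, (coordMap (k+1) x) j ^ (α j - 1) := by
  have hcm : Measurable (coordMap (k+1)) := by
    refine measurable_pi_lambda _ fun j => ?_
    unfold coordMap
    split_ifs
    · fun_prop
    · fun_prop
  have hmem : ∀ x, x ∈ simplexDom (k+1) ↔ ∀ j, 0 ≤ coordMap (k+1) x j := by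
    intro x
    rw [show coordMap (k+1) x = _ from vc_coord k x, Fin.forall_fin_succ']
    simp [simplexDom]
  have hsum : ∀ x, ∑ j, coordMap (k+1) x j = 1 := by
    intro x
    rw [show coordMap (k+1) x = _ from vc_coord k x, Fin.sum_univ_castSucc]
    simp
  have hO : MeasurableSet (Set.pi Set.univ fun _ : Fin (k+1) => Set.Ici (0:ℝ)) :=
    MeasurableSet.univ_pi fun _ => measurableSet_Ici
  have hS : MeasurableSet (simplexDom (k+1)) := by
    have : simplexDom (k+1) = coordMap (k+1) ⁻¹' (Set.pi Set.univ fun _ : Fin (k+1) => Set.Ici (0:ℝ)) := by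
      ext x; rw [hmem]; exact ⟨fun hx j _ => hx j, fun hx j => hx j (Set.mem_univ _)⟩
    rw [this]; exact hcm hO
  have hgm : Measurable fun θ : Fin (k+1) → ℝ => h θ * ∏ j, (θ j ^ (α j - 1) * Real.exp (-θ j)) := by
    fun_prop
  have hdm : Measurable fun θ : Fin (k+1) → ℝ => h θ * ∏ j, θ j ^ (α j - 1) := by
    fun_prop
  have hA : 0 < (d:ℝ) + ∑ j, α j := by
    have : 0 < ∑ j, α j := Finset.sum_pos (fun j _ => hα j) Finset.univ_nonempty
    positivity
  rw [← Measure.restrict_pi_pi, Measure.restrict_congr_set (Measure.univ_pi_Ioi_ae_eq_Ici), ← Set.pi_univ_Ici]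
  rw [integral_eq_lintegral_of_nonneg_ae ?_ hgm.aestronglyMeasurable]
  swap
  · filter_upwards [ae_restrict_mem hO] with θ hθ
    have hθ' : ∀ j, 0 ≤ θ j := fun j => hθ j (Set.mem_univ _)
    exact mul_nonneg (h0 θ hθ') (Finset.prod_nonneg fun j _ => mul_nonneg (Real.rpow_nonneg (hθ' j) _) (Real.exp_pos _).le)
  have hdnn : ∀ x ∈ simplexDom (k+1), 0 ≤ h (coordMap (k+1) x) * ∏ j, (coordMap (k+1) x) j ^ (α j - 1) := by
    intro x hx
    exact mul_nonneg (h0 _ ((hmem x).1 hx)) (Finset.prod_nonneg fun j _ => Real.rpow_nonneg ((hmem x).1 hx j) _)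
  have hdc : Measurable fun x => h (coordMap (k+1) x) * ∏ j, (coordMap (k+1) x) j ^ (α j - 1) := hdm.comp hcm
  rw [integral_eq_lintegral_of_nonneg_ae ?_ hdc.aestronglyMeasurable]
  swap
  · filter_upwards [ae_restrict_mem hS] with x hx using hdnn x hx
  rw [← volume_pi, ← lintegral_indicator hO, vc_polar k _ (hgm.ennreal_ofReal.indicator hO)]
  swap
  · rintro θ ⟨j, hj⟩
    refine Set.indicator_of_notMem ?_ _
    intro hc
    have := hc j (Set.mem_univ _)
    simp at this
    linarith
  have key : ∀ s ∈ Set.Ioi (0:ℝ), ENNReal.ofReal (s ^ k) * ∫⁻ x : Fin k → ℝ,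
      (Set.pi Set.univ fun _ : Fin (k+1) => Set.Ici (0:ℝ)).indicator
        (fun θ => ENNReal.ofReal (h θ * ∏ j, (θ j ^ (α j - 1) * Real.exp (-θ j)))) (s • coordMap (k+1) x)
      = ENNReal.ofReal (s ^ ((d:ℝ) + ∑ j, α j - 1) * Real.exp (-s)) *
        ∫⁻ x in simplexDom (k+1), ENNReal.ofReal (h (coordMap (k+1) x) * ∏ j, (coordMap (k+1) x) j ^ (α j - 1)) := by
    intro s hs'
    have hs0 : 0 < s := hs'
    rw [← lintegral_indicator hS, ← lintegral_const_mul' _ _ ENNReal.ofReal_ne_top,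
      ← lintegral_const_mul' _ _ ENNReal.ofReal_ne_top]
    refine lintegral_congr fun x => ?_
    by_cases hx : x ∈ simplexDom (k+1)
    · have hx' := (hmem x).1 hx
      rw [Set.indicator_of_mem hx, Set.indicator_of_mem, ← ENNReal.ofReal_mul (by positivity),
        ← ENNReal.ofReal_mul (by positivity)]
      · congr 1
        rw [hs]
        have e1 : ∏ j, ((s • coordMap (k+1) x) j ^ (α j - 1) * Real.exp (-(s • coordMap (k+1) x) j))
            = s ^ (∑ j, (α j - 1)) * Real.exp (-s) * ∏ j, (coordMap (k+1) x) j ^ (α j - 1) := by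
          rw [Finset.prod_mul_distrib, ← Real.exp_sum]
          have : ∑ j, -(s • coordMap (k+1) x) j = -s := by
            simp [← Finset.mul_sum, hsum]
          rw [this, Real.rpow_sum_of_pos hs0]
          have : ∀ j, (s • coordMap (k+1) x) j ^ (α j - 1) = s ^ (α j - 1) * (coordMap (k+1) x) j ^ (α j - 1) := fun j => by
            rw [Pi.smul_apply, smul_eq_mul, Real.mul_rpow hs0.le (hx' j)]
          simp_rw [this]
          rw [Finset.prod_mul_distrib]; ring
        rw [e1]
        have e2 : s ^ ((d:ℝ) + ∑ j, α j - 1) = s ^ k * s ^ d * s ^ (∑ j, (α j - 1)) := by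
          rw [← Real.rpow_natCast, ← Real.rpow_natCast, ← Real.rpow_add hs0, ← Real.rpow_add hs0]
          congr 1
          simp [Finset.sum_sub_distrib]; ring
        rw [e2]; ring
      · intro j _
        exact mul_nonneg hs0.le (hx' j)
    · rw [Set.indicator_of_notMem hx, Set.indicator_of_notMem, mul_zero, mul_zero]
      intro hc
      refine hx ((hmem x).2 fun j => ?_)
      have : 0 ≤ s * coordMap (k+1) x j := hc j (Set.mem_univ _)
      exact nonneg_of_mul_nonneg_right this hs0
  rw [setLIntegral_congr_fun measurableSet_Ioi key, lintegral_mul_const _ (by fun_prop), ENNReal.toReal_mul]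
  congr 1
  rw [← vc_gamma_eq _ hA, integral_eq_lintegral_of_nonneg_ae ?_ (by fun_prop)]
  filter_upwards [ae_restrict_mem measurableSet_Ioi] with s hs'
  have hs0 : 0 < s := hs'
  positivity

lemma vc_nonneg (n m : ℕ) (α : Fin m → ℝ) (hα : ∀ j, 0 < α j) (β : Fin n → Fin m → ℝ) (z' : Fin m)
    (hβ : ∀ i, ∀ j, j ≠ z' → 0 ≤ β i j) (K : Finset (Fin n)) : 0 ≤ ptildeDel n m α β z' K := by
  unfold ptildeDel
  refine setIntegral_nonneg ?_ fun θ hθ => ?_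
  · have hs : {θ : {j : Fin m // j ≠ z'} → ℝ | ∀ j, 0 < θ j} = Set.pi Set.univ fun _ => Set.Ioi 0 := by
      ext θ; simp
    rw [hs]; exact MeasurableSet.univ_pi fun _ => measurableSet_Ioi
  · refine mul_nonneg (Finset.prod_nonneg fun j _ => ?_) (Finset.prod_nonneg fun i _ => Finset.sum_nonneg fun j _ => mul_nonneg (hβ i _ j.2) (hθ j).le)
    have := hθ j
    have := Real.Gamma_pos_of_pos (hα j.1)
    positivity

lemma vc_empty (n k : ℕ) (α : Fin (k+1) → ℝ) (hα : ∀ j, 0 < α j) (β : Fin n → Fin (k+1) → ℝ) (z : Fin (k+1)) :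
    ptildeDel n (k+1) α β z ∅ = 1 := by
  rw [vc_ptilde]
  simp only [Finset.prod_empty, mul_one]
  rw [integral_fintype_prod_eq_prod (fun j x => x ^ (α (z.succAbove j) - 1) * Real.exp (-x))]
  simp_rw [vc_gamma_eq _ (hα _)]
  exact div_self (Finset.prod_pos fun j _ => Real.Gamma_pos_of_pos (hα _)).ne'


theorem posterior_mean_virtual_cause (n m : ℕ) (hn : 1 ≤ n) (hm : 2 ≤ m)
    (α : Fin m → ℝ) (hα : ∀ j, 0 < α j)
    (β : Fin n → Fin m → ℝ) (z' : Fin m) (hαz : α z' = 1)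
    (ε : ℝ) (hε : 0 < ε) (hβz : ∀ i, β i z' = ε)
    (hβ : ∀ i, ∀ j, j ≠ z' → 0 ≤ β i j) :
    let e : ℕ → ℝ := fun k =>
      ∑ I ∈ Finset.powersetCard k (Finset.univ : Finset (Fin n)),
        ptildeDel n m α β z' (Finset.univ \ I)
    0 < (∑ k ∈ Finset.range (n + 1), (k.factorial : ℝ) * e k * ε ^ k) ∧
      ((n : ℝ) + ∑ j, α j) *
        (dirExp m α (fun θ => θ z' * ∏ i : Fin n, ∑ j, β i j * θ j) /
          dirExp m α (fun θ => ∏ i : Fin n, ∑ j, β i j * θ j))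
      = (∑ k ∈ Finset.range (n + 1), ((k + 1).factorial : ℝ) * e k * ε ^ k) /
        (∑ k ∈ Finset.range (n + 1), (k.factorial : ℝ) * e k * ε ^ k) := by
  intro e
  obtain ⟨k, rfl⟩ : ∃ k, m = k + 1 := ⟨m - 1, by omega⟩
  have he0 : ∀ l, 0 ≤ e l := fun l => Finset.sum_nonneg fun I _ => vc_nonneg n (k+1) α hα β z' hβ _
  have hen : e n = 1 := by
    have : Finset.powersetCard n (Finset.univ : Finset (Fin n)) = {Finset.univ} := by
      have := Finset.powersetCard_self (Finset.univ : Finset (Fin n))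
      rwa [Finset.card_univ, Fintype.card_fin] at this
    simp only [e, this, Finset.sum_singleton, Finset.sdiff_self]
    exact vc_empty n k α hα β z'
  have hpos : 0 < ∑ l ∈ Finset.range (n + 1), (l.factorial : ℝ) * e l * ε ^ l := by
    refine Finset.sum_pos' (fun l _ => ?_) ⟨n, by simp, ?_⟩
    · have := he0 l
      positivity
    · rw [hen]; positivity
  refine ⟨hpos, ?_⟩
  have hβ0 : ∀ i j, 0 ≤ β i j := fun i j => by
    by_cases hj : j = z'
    · rw [hj, hβz]; exact hε.le
    · exact hβ i j hj
  have hΓ : 0 < ∏ j, Real.Gamma (α j) := Finset.prod_pos fun j _ => Real.Gamma_pos_of_pos (hα j)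
  have hA : 0 < ∑ j, α j := Finset.sum_pos (fun j _ => hα j) Finset.univ_nonempty
  have main : ∀ c : ℕ, Real.Gamma (((n + c : ℕ) : ℝ) + ∑ j, α j) *
      dirExp (k+1) α (fun θ => θ z' ^ c * ∏ i : Fin n, ∑ j, β i j * θ j)
      = Real.Gamma (∑ j, α j) * ∑ l ∈ Finset.range (n + 1), ((l + c).factorial : ℝ) * e l * ε ^ l := by
    intro c
    have h1 := vc_split n k c α hα β z' hαz ε hβz
    rw [vc_dir k α hα (n + c) (fun θ => θ z' ^ c * ∏ i : Fin n, ∑ j, β i j * θ j)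
      (by fun_prop) ?_ ?_] at h1
    · unfold dirExp
      rw [integral_div, mul_div_assoc', h1]
      have := Real.Gamma_pos_of_pos hA
      field_simp
      rfl
    · intro θ hθ
      exact mul_nonneg (pow_nonneg (hθ _) _) (Finset.prod_nonneg fun i _ =>
        Finset.sum_nonneg fun j _ => mul_nonneg (hβ0 i j) (hθ j))
    · intro s θ
      simp only [Pi.smul_apply, smul_eq_mul, mul_left_comm _ s, ← Finset.mul_sum]
      rw [Finset.prod_mul_distrib]
      simp only [Finset.prod_const, Finset.card_univ, Fintype.card_fin]
      ring
  have m0 := main 0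
  have m1 := main 1
  simp only [pow_zero, one_mul, add_zero] at m0
  simp only [pow_one] at m1
  have hnA : 0 < (n:ℝ) + ∑ j, α j := by positivity
  rw [show (((n + 1 : ℕ) : ℝ) + ∑ j, α j) = ((n:ℝ) + ∑ j, α j) + 1 by push_cast; ring,
    Real.Gamma_add_one hnA.ne'] at m1
  have hG1 := Real.Gamma_pos_of_pos hA
  have hG2 := Real.Gamma_pos_of_pos hnA
  generalize dirExp (k+1) α (fun θ => ∏ i : Fin n, ∑ j, β i j * θ j) = D at *
  generalize dirExp (k+1) α (fun θ => θ z' * ∏ i : Fin n, ∑ j, β i j * θ j) = N at *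
  generalize (∑ l ∈ Finset.range (n + 1), (l.factorial : ℝ) * e l * ε ^ l) = P at *
  generalize (∑ l ∈ Finset.range (n + 1), ((l + 1).factorial : ℝ) * e l * ε ^ l) = Q at *
  generalize Real.Gamma ((n:ℝ) + ∑ j, α j) = g at *
  generalize Real.Gamma (∑ j, α j) = g' at *
  have hD : D ≠ 0 := by
    rintro rfl
    have := mul_pos hG1 hpos
    linarith
  rw [mul_div_assoc', div_eq_div_iff hD hpos.ne']
  have : g * g' ≠ 0 := (mul_pos hG2 hG1).ne'
  apply mul_left_cancel₀ this
  linear_combination (g' * P) * m1 - (g' * Q) * m0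
end
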